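/- arXiv:1510.04346 — 6 statements merged into one kernel-verified Lean document; each statement's English description precedes it below -/
import Mathlib

section
/- The characteristic polynomial of M factors as det(λ I_{2n} − M) = (λ − 1 + β)^{n−1} (λ − 1 + α)^{n−1} [(λ−1)² + (α+β)(λ−1) + 2αβ], as an identity of polynomials in λ over ℝ. -/
open Matrix Polynomial

/-- The 2n×2n transition matrix M = [[(1−α)Iₙ, α·1ₙᵀa], [−β·1ₙᵀb, (1−β)Iₙ]]. -/
noncomputable def transM (n : ℕ) (α β : ℝ) (a b : Fin n → ℝ) :
    Matrix (Fin n ⊕ Fin n) (Fin n ⊕ Fin n) ℝ :=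
  Matrix.fromBlocks ((1 - α) • (1 : Matrix (Fin n) (Fin n) ℝ))
    (Matrix.of fun _ j => α * a j)
    (Matrix.of fun _ j => -β * b j)
    ((1 - β) • (1 : Matrix (Fin n) (Fin n) ℝ))

/-- The determinant of a block matrix with scalar diagonal blocks and rank-one off-diagonal blocks. -/
theorem det_fromBlocks_scalar_vecMulVec {R ι : Type*} [CommRing R] [Fintype ι] [DecidableEq ι]
    (p q : R) (hq : IsRegular q) (u v w z : ι → R) :
    (fromBlocks (scalar ι p) (vecMulVec u v) (vecMulVec w z) (scalar ι q)).det =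
      (p * q) ^ Fintype.card ι - (v ⬝ᵥ w) * (u ⬝ᵥ z) * (p * q) ^ (Fintype.card ι - 1) := by
  have hmul : fromBlocks (scalar ι p) (vecMulVec u v) (vecMulVec w z) (scalar ι q) *
      fromBlocks (scalar ι q) 0 (-vecMulVec w z) 1 =
      fromBlocks (scalar ι (p * q) - vecMulVec u ((v ⬝ᵥ w) • z)) (vecMulVec u v) 0
        (scalar ι q) := by
    rw [fromBlocks_multiply]
    congr 1
    · rw [mul_neg, vecMulVec_mul_vecMulVec, ← map_mul, sub_eq_add_neg]
    · simp
    · rw [mul_neg, (scalar_commute q (Commute.all q) (vecMulVec w z)).eq, add_neg_cancel]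
    · simp
  have hdet := congrArg det hmul
  rw [det_mul, det_fromBlocks_zero₁₂, det_fromBlocks_zero₂₁, det_one, mul_one,
    ← eval_charpoly, charpoly_vecMulVec] at hdet
  have hreg : IsRegular (scalar ι q).det := by
    simpa [det_diagonal] using hq.pow (Fintype.card ι)
  simpa using hreg.right hdet

/-- det(λ I₂ₙ − M) = (λ−1+β)^{n−1} (λ−1+α)^{n−1} [(λ−1)² + (α+β)(λ−1) + 2αβ]
as an identity of polynomials in λ over ℝ. -/
theorem charpoly_factorization (n : ℕ) (hn : 1 ≤ n) (α β : ℝ) (a b : Fin n → ℝ)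
    (ha : (∀ i, 0 < a i) ∧ ∑ i, a i = 1)
    (hb : (∀ i, 0 < b i) ∧ ∑ i, b i = 1) :
    (transM n α β a b).charpoly =
      (X - C (1 - β)) ^ (n - 1) * (X - C (1 - α)) ^ (n - 1) *
        ((X - 1) ^ 2 + C (α + β) * (X - 1) + C (2 * α * β)) := by
  obtain ⟨-, ha⟩ := ha
  obtain ⟨-, hb⟩ := hb
  have hblocks : (transM n α β a b).charmatrix =
      fromBlocks (scalar (Fin n) (X - C (1 - α))) (vecMulVec 1 fun j => -C (α * a j))
        (vecMulVec 1 fun j => C (β * b j)) (scalar (Fin n) (X - C (1 - β))) := by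
    rw [transM, charmatrix_fromBlocks]
    congr 1 <;> ext1 i j
    · obtain rfl | hij := eq_or_ne i j <;> simp [*]
    · simp [vecMulVec_apply]
    · simp [vecMulVec_apply]
    · obtain rfl | hij := eq_or_ne i j <;> simp [*]
  have hα : (fun j => -C (α * a j)) ⬝ᵥ 1 = -C α := by
    simp only [dotProduct_one, Finset.sum_neg_distrib, ← map_sum, ← Finset.mul_sum, ha, mul_one]
  have hβ : 1 ⬝ᵥ (fun j => C (β * b j)) = C β := by
    simp only [one_dotProduct, ← map_sum, ← Finset.mul_sum, hb, mul_one]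
  rw [charpoly, hblocks, det_fromBlocks_scalar_vecMulVec _ _ (monic_X_sub_C _).isRegular, hα, hβ,
    Fintype.card_fin]
  obtain ⟨m, rfl⟩ := Nat.exists_eq_add_of_le' hn
  simp only [Nat.add_sub_cancel, map_sub, map_add, map_mul, map_one, map_ofNat, pow_succ, mul_pow]
  ring
end

section
/- For n ≥ 2, the set of real eigenvalues of M (i.e. real roots λ of det(λ I_{2n} − M) = 0) equals {1−α, 1−β, λ₃, λ₄} if Δ ≥ 0, and equals {1−α, 1−β} if Δ < 0, where λ₃ = (2 − α − β + √Δ)/2 and λ₄ = (2 − α − β − √Δ)/2. -/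
open Matrix

lemma smul_one_sub_transM_mulVec_elim (n : ℕ) (α β lam : ℝ) (a b u w : Fin n → ℝ) :
    (lam • (1 : Matrix (Fin n ⊕ Fin n) (Fin n ⊕ Fin n) ℝ) - transM n α β a b) *ᵥ Sum.elim u w =
      Sum.elim (fun i => (lam - (1 - α)) * u i - α * ∑ j, a j * w j)
        (fun i => (lam - (1 - β)) * w i + β * ∑ j, b j * u j) := by
  rw [Matrix.sub_mulVec, Matrix.smul_mulVec, Matrix.one_mulVec, transM,
    Matrix.fromBlocks_mulVec]
  ext (i | i)
  · simp [Matrix.smul_mulVec, Matrix.mulVec, dotProduct, Finset.mul_sum, mul_assoc]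
    ring
  · simp [Matrix.smul_mulVec, Matrix.mulVec, dotProduct, Finset.mul_sum, mul_assoc]
    ring

lemma det_smul_one_sub_transM_eq_zero_iff {n : ℕ} (hn : 2 ≤ n) (α β lam : ℝ) {a b : Fin n → ℝ}
    (ha : ∑ i, a i = 1) (hb : ∑ i, b i = 1) :
    (lam • (1 : Matrix (Fin n ⊕ Fin n) (Fin n ⊕ Fin n) ℝ) - transM n α β a b).det = 0 ↔
      lam = 1 - α ∨ lam = 1 - β ∨ (lam - (1 - α)) * (lam - (1 - β)) + α * β = 0 := by
  rw [← Matrix.exists_mulVec_eq_zero_iff]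
  constructor
  · rintro ⟨v, hv, h⟩
    obtain ⟨u, w, rfl⟩ : ∃ u w, v = Sum.elim u w := ⟨_, _, (Sum.elim_comp_inl_inr v).symm⟩
    rw [smul_one_sub_transM_mulVec_elim] at h
    by_contra! hne
    obtain ⟨hx, hy, hxy⟩ := hne
    rw [← sub_ne_zero] at hx hy
    have hu (i) : (lam - (1 - α)) * u i - α * ∑ j, a j * w j = 0 := congrFun h (Sum.inl i)
    have hw (i) : (lam - (1 - β)) * w i + β * ∑ j, b j * u j = 0 := congrFun h (Sum.inr i)
    have hU : (lam - (1 - α)) * ∑ j, b j * u j = α * ∑ j, a j * w j := by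
      calc _ = ∑ j, b j * (α * ∑ j, a j * w j) := by
            rw [Finset.mul_sum]
            exact Finset.sum_congr rfl fun i _ => by linear_combination b i * hu i
        _ = _ := by rw [← Finset.sum_mul, hb, one_mul]
    have hW : (lam - (1 - β)) * ∑ j, a j * w j = -(β * ∑ j, b j * u j) := by
      calc _ = ∑ j, a j * -(β * ∑ j, b j * u j) := by
            rw [Finset.mul_sum]
            exact Finset.sum_congr rfl fun i _ => by linear_combination a i * hw i
        _ = _ := by rw [← Finset.sum_mul, ha, one_mul]
    have hU0 : ∑ j, b j * u j = 0 := (mul_eq_zero.mp (by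
      linear_combination (lam - (1 - β)) * hU + α * hW :
        ((lam - (1 - α)) * (lam - (1 - β)) + α * β) * ∑ j, b j * u j = 0)).resolve_left hxy
    have hW0 : ∑ j, a j * w j = 0 := by simpa [hU0, hy] using hW
    refine hv (funext ?_)
    rintro (i | i)
    · simpa [hW0, hx] using hu i
    · simpa [hU0, hy] using hw i
  · intro h
    suffices ∃ u w : Fin n → ℝ, Sum.elim u w ≠ 0 ∧
        (∀ i, (lam - (1 - α)) * u i - α * ∑ j, a j * w j = 0) ∧
        (∀ i, (lam - (1 - β)) * w i + β * ∑ j, b j * u j = 0) by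
      obtain ⟨u, w, hne, hu, hw⟩ := this
      refine ⟨Sum.elim u w, hne, ?_⟩
      rw [smul_one_sub_transM_mulVec_elim]
      ext (i | i)
      · exact hu i
      · exact hw i
    have : Nontrivial (Fin n) := Fin.nontrivial_iff_two_le.mpr hn
    by_cases hx : lam = 1 - α
    · obtain ⟨u, hu, hbu⟩ := exists_ne_zero_dotProduct_eq_zero b
      rw [dotProduct_comm, dotProduct] at hbu
      exact ⟨u, 0, fun h => hu (funext fun i => congrFun h (Sum.inl i)), by simp [hx],
        by simp [hbu]⟩
    by_cases hy : lam = 1 - β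
    · obtain ⟨w, hw, haw⟩ := exists_ne_zero_dotProduct_eq_zero a
      rw [dotProduct_comm, dotProduct] at haw
      exact ⟨0, w, fun h => hw (funext fun i => congrFun h (Sum.inr i)), by simp [haw],
        by simp [hy]⟩
    have hxy := (h.resolve_left hx).resolve_left hy
    refine ⟨fun _ => α, fun _ => lam - (1 - α), fun h => hx (sub_eq_zero.mp
      (congrFun h (Sum.inr ⟨0, by omega⟩))), fun i => ?_, fun i => ?_⟩
    · rw [← Finset.sum_mul, ha]
      ring
    · rw [← Finset.sum_mul, hb]
      linear_combination hxy

/-- for n ≥ 2 the set of real roots λ of det(λ I₂ₙ − M) = 0 equals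
{1−α, 1−β, λ₃, λ₄} if Δ ≥ 0 and {1−α, 1−β} if Δ < 0, where Δ = α² + β² − 6αβ,
λ₃ = (2 − α − β + √Δ)/2 and λ₄ = (2 − α − β − √Δ)/2. -/
theorem real_eigenvalues_of_M (n : ℕ) (hn : 2 ≤ n) (α β : ℝ) (a b : Fin n → ℝ)
    (ha : (∀ i, 0 < a i) ∧ ∑ i, a i = 1)
    (hb : (∀ i, 0 < b i) ∧ ∑ i, b i = 1) :
    (0 ≤ α ^ 2 + β ^ 2 - 6 * α * β →
      {lam : ℝ | (lam • (1 : Matrix (Fin n ⊕ Fin n) (Fin n ⊕ Fin n) ℝ)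
          - transM n α β a b).det = 0} =
        ({1 - α, 1 - β,
          (2 - α - β + Real.sqrt (α ^ 2 + β ^ 2 - 6 * α * β)) / 2,
          (2 - α - β - Real.sqrt (α ^ 2 + β ^ 2 - 6 * α * β)) / 2} : Set ℝ)) ∧
    (α ^ 2 + β ^ 2 - 6 * α * β < 0 →
      {lam : ℝ | (lam • (1 : Matrix (Fin n ⊕ Fin n) (Fin n ⊕ Fin n) ℝ)
          - transM n α β a b).det = 0} =
        ({1 - α, 1 - β} : Set ℝ)) := by
  have hquad (lam : ℝ) : 4 * ((lam - (1 - α)) * (lam - (1 - β)) + α * β) =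
      (2 * lam - (2 - α - β)) ^ 2 - (α ^ 2 + β ^ 2 - 6 * α * β) := by ring
  constructor
  · intro hΔ
    ext lam
    simp only [Set.mem_ofPred_eq, Set.mem_insert_iff, Set.mem_singleton_iff,
      det_smul_one_sub_transM_eq_zero_iff hn α β lam ha.2 hb.2]
    refine or_congr_right (or_congr_right ?_)
    have hs := Real.sq_sqrt hΔ
    set s := Real.sqrt (α ^ 2 + β ^ 2 - 6 * α * β)
    have hfactor : (lam - (1 - α)) * (lam - (1 - β)) + α * β =
        (lam - (2 - α - β + s) / 2) * (lam - (2 - α - β - s) / 2) := by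
      linear_combination hs / 4
    rw [hfactor, mul_eq_zero, sub_eq_zero, sub_eq_zero]
  · intro hΔ
    ext lam
    simp only [Set.mem_ofPred_eq, Set.mem_insert_iff, Set.mem_singleton_iff,
      det_smul_one_sub_transM_eq_zero_iff hn α β lam ha.2 hb.2]
    refine or_congr_right (or_iff_left ?_)
    intro h
    nlinarith [hquad lam, sq_nonneg (2 * lam - (2 - α - β))]
end

section
/- If β ≠ 0 and min(d₁, d₂) < α < max(d₁, d₂) (equivalently Δ < 0), then M cannot be diagonalized over ℝ: there is no invertible matrix Q ∈ M_{2n}(ℝ) such that Q⁻¹ M Q is a diagonal matrix. -/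
open Matrix

/-- If `α` lies strictly between the roots `(3 ± 2√2) β`, then `α² + β² - 6αβ < 0`. -/
lemma discrim_neg_of_between {α β : ℝ}
    (h1 : min ((3 - 2 * Real.sqrt 2) * β) ((3 + 2 * Real.sqrt 2) * β) < α)
    (h2 : α < max ((3 - 2 * Real.sqrt 2) * β) ((3 + 2 * Real.sqrt 2) * β)) :
    α ^ 2 + β ^ 2 - 6 * α * β < 0 := by
  have hs : Real.sqrt 2 ^ 2 = 2 := Real.sq_sqrt (by norm_num)
  have key : α ^ 2 + β ^ 2 - 6 * α * β =
      (α - (3 - 2 * Real.sqrt 2) * β) * (α - (3 + 2 * Real.sqrt 2) * β) := by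
    linear_combination 4 * β ^ 2 * hs
  rw [key]
  rcases le_total ((3 - 2 * Real.sqrt 2) * β) ((3 + 2 * Real.sqrt 2) * β) with h | h
  · rw [min_eq_left h] at h1
    rw [max_eq_right h] at h2
    exact mul_neg_of_pos_of_neg (sub_pos.2 h1) (sub_neg.2 h2)
  · rw [min_eq_right h] at h1
    rw [max_eq_left h] at h2
    exact mul_neg_of_neg_of_pos (sub_neg.2 h2) (sub_pos.2 h1)

/-- When the discriminant is negative, every real eigenvector of `transM` has an upper half
orthogonal to `b`. -/
lemma dotProduct_eq_zero_of_transM_mulVec {n : ℕ} {α β μ : ℝ} {a b : Fin n → ℝ}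
    (ha : ∑ i, a i = 1) (hb : ∑ i, b i = 1) (hΔ : α ^ 2 + β ^ 2 - 6 * α * β < 0)
    {x : Fin n ⊕ Fin n → ℝ} (hx : transM n α β a b *ᵥ x = μ • x) :
    ∑ i, b i * x (Sum.inl i) = 0 := by
  set s := ∑ i, b i * x (Sum.inl i) with hs
  set t := ∑ i, a i * x (Sum.inr i) with ht
  have top (i : Fin n) : (1 - α) * x (Sum.inl i) + α * t = μ * x (Sum.inl i) := by
    have := congrFun hx (Sum.inl i)
    simpa [transM, mulVec, dotProduct, Matrix.one_apply, mul_assoc, ← Finset.mul_sum, ← ht]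
      using this
  have bot (i : Fin n) : -β * s + (1 - β) * x (Sum.inr i) = μ * x (Sum.inr i) := by
    have := congrFun hx (Sum.inr i)
    simpa [transM, mulVec, dotProduct, Matrix.one_apply, mul_assoc, ← Finset.mul_sum, ← hs]
      using this
  have hst : (1 - α - μ) * s + α * t = 0 := by
    have : ∑ i, b i * ((1 - α - μ) * x (Sum.inl i) + α * t) = 0 :=
      Finset.sum_eq_zero fun i _ => by linear_combination b i * top i
    simp only [mul_add, Finset.sum_add_distrib, ← Finset.sum_mul, hb, mul_left_comm (b _),
      ← Finset.mul_sum, ← hs] at this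
    linarith
  have hts : (1 - β - μ) * t - β * s = 0 := by
    have : ∑ i, a i * ((1 - β - μ) * x (Sum.inr i) + -β * s) = 0 :=
      Finset.sum_eq_zero fun i _ => by linear_combination a i * bot i
    simp only [mul_add, Finset.sum_add_distrib, ← Finset.sum_mul, ha, mul_left_comm (a _),
      ← Finset.mul_sum, ← ht] at this
    linarith
  have hdet : ((1 - α - μ) * (1 - β - μ) + α * β) * s = 0 := by
    linear_combination (1 - β - μ) * hst - α * hts
  refine (mul_eq_zero.1 hdet).resolve_left (ne_of_gt ?_)
  nlinarith [sq_nonneg (2 - α - β - 2 * μ)]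

/-- if β ≠ 0 and min(d₁,d₂) < α < max(d₁,d₂) (where d₁ = (3−2√2)β and
d₂ = (3+2√2)β), then M cannot be diagonalized over ℝ: there is no invertible Q with
Q⁻¹MQ diagonal. -/
theorem M_not_diagonalizable (n : ℕ) (hn : 1 ≤ n) (α β : ℝ) (a b : Fin n → ℝ)
    (ha : (∀ i, 0 < a i) ∧ ∑ i, a i = 1)
    (hb : (∀ i, 0 < b i) ∧ ∑ i, b i = 1)
    (hβ : β ≠ 0)
    (h1 : min ((3 - 2 * Real.sqrt 2) * β) ((3 + 2 * Real.sqrt 2) * β) < α)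
    (h2 : α < max ((3 - 2 * Real.sqrt 2) * β) ((3 + 2 * Real.sqrt 2) * β)) :
    ¬ ∃ Q : Matrix (Fin n ⊕ Fin n) (Fin n ⊕ Fin n) ℝ,
        IsUnit Q ∧ (Q⁻¹ * transM n α β a b * Q).IsDiag := by
  rintro ⟨Q, hQ, hD⟩
  have hdet : IsUnit Q.det := (Matrix.isUnit_iff_isUnit_det Q).1 hQ
  set d := (Q⁻¹ * transM n α β a b * Q).diag
  have hMQ : transM n α β a b * Q = Q * diagonal d := by
    rw [hD.diagonal_diag, Matrix.mul_assoc, Matrix.mul_nonsing_inv_cancel_left _ _ hdet]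
  have hv : Sum.elim b 0 ᵥ* Q = 0 := by
    ext j
    have hcol : transM n α β a b *ᵥ Q.col j = d j • Q.col j := by
      ext i
      have := congrFun (congrFun hMQ i) j
      rw [Matrix.mul_diagonal] at this
      simpa [mul_comm, Matrix.mul_apply, mulVec, dotProduct] using this
    simpa [vecMul, dotProduct] using
      dotProduct_eq_zero_of_transM_mulVec ha.2 hb.2 (discrim_neg_of_between h1 h2) hcol
  have hzero : Sum.elim b 0 = (0 : Fin n ⊕ Fin n → ℝ) :=
    Matrix.vecMul_injective_of_isUnit hQ (by simpa using hv)
  exact (hb.1 ⟨0, hn⟩).ne' (congrFun hzero (Sum.inl ⟨0, hn⟩))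
end

section
/- If α ≠ 0, β ≠ 0 and either α < min(d₁, d₂) or α > max(d₁, d₂) (equivalently Δ > 0), then M is diagonalizable over ℝ: there exists an invertible matrix Q ∈ M_{2n}(ℝ) such that Q⁻¹ M Q = diag(λ₁ I_{n−1}, λ₃, λ₂ I_{n−1}, λ₄), the diagonal matrix whose first n−1 diagonal entries are λ₁ = 1−α, whose n-th diagonal entry is λ₃ = (2 − α − β + √Δ)/2, whose next n−1 diagonal entries are λ₂ = 1−β, and whose last diagonal entry is λ₄ = (2 − α − β − √Δ)/2. -/
open Matrix

/-- The diagonal matrix diag(λ₁ I_{n−1}, λ₃, λ₂ I_{n−1}, λ₄): the first n entries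
(indexed by the left summand) are n−1 copies of λ₁ followed by λ₃, the last n entries
(indexed by the right summand) are n−1 copies of λ₂ followed by λ₄. -/
noncomputable def diagJ (n : ℕ) (l1 l3 l2 l4 : ℝ) :
    Matrix (Fin n ⊕ Fin n) (Fin n ⊕ Fin n) ℝ :=
  Matrix.diagonal (Sum.elim (fun i : Fin n => if (i : ℕ) < n - 1 then l1 else l3)
    (fun i : Fin n => if (i : ℕ) < n - 1 then l2 else l4))

theorem transM_mulVec (n : ℕ) (α β : ℝ) (a b x y : Fin n → ℝ) :
    transM n α β a b *ᵥ Sum.elim x y =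
      Sum.elim (fun i => (1 - α) * x i + α * (a ⬝ᵥ y))
        (fun i => (1 - β) * y i - β * (b ⬝ᵥ x)) := by
  have key (c : ℝ) (u v : Fin n → ℝ) (i : Fin n) :
      ((Matrix.of fun _ j => c * u j : Matrix (Fin n) (Fin n) ℝ) *ᵥ v) i = c * (u ⬝ᵥ v) := by
    simp [Matrix.mulVec, dotProduct, Finset.mul_sum, mul_assoc]
  rw [transM, Matrix.fromBlocks_mulVec]
  ext (i | i)
  · simp [key, Matrix.smul_mulVec]
  · simp only [Sum.elim_comp_inl, Sum.elim_comp_inr, Sum.elim_inr, Pi.add_apply, key,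
      Matrix.smul_mulVec, Matrix.one_mulVec, Pi.smul_apply, smul_eq_mul]
    ring

/-- The vector `e_j - b_j • 1`, which is orthogonal to `b` when the entries of `b` sum to `1`. -/
def centeredBasis {n : ℕ} (b : Fin n → ℝ) (j i : Fin n) : ℝ :=
  Pi.single (M := fun _ => ℝ) j 1 i - b j

theorem dotProduct_centeredBasis {n : ℕ} {b : Fin n → ℝ} (hb : ∑ i, b i = 1) (j : Fin n) :
    b ⬝ᵥ centeredBasis b j = 0 := by
  have h : centeredBasis b j = Pi.single j 1 - fun _ => b j := rfl
  rw [h, dotProduct_sub, dotProduct_single]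
  simp [dotProduct, ← Finset.sum_mul, hb]

/-- A combination of the vectors `centeredBasis b j` for `j ≠ l` and the constant vector `1`
vanishes only when all its coefficients do. -/
theorem eq_zero_of_centeredBasis_combination {n : ℕ} {b : Fin n → ℝ} (hb : ∑ i, b i = 1)
    (l : Fin n) (c : Fin n → ℝ) (s : ℝ)
    (h : ∀ i, ∑ j, (if j = l then 0 else c j * centeredBasis b j i) + s = 0) :
    s = 0 ∧ ∀ j, j ≠ l → c j = 0 := by
  have hs : s = 0 := by
    have h₀ : ∑ i, b i * (∑ j, (if j = l then 0 else c j * centeredBasis b j i) + s) = 0 := by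
      simp [h]
    simp only [mul_add, Finset.sum_add_distrib, ← Finset.sum_mul, hb, Finset.mul_sum] at h₀
    rw [Finset.sum_comm, Finset.sum_eq_zero] at h₀
    · simpa using h₀
    · intro j _
      split_ifs
      · simp
      · have := dotProduct_centeredBasis hb j
        rw [dotProduct] at this
        calc ∑ i, b i * (c j * centeredBasis b j i)
            = c j * ∑ i, b i * centeredBasis b j i := by
              rw [Finset.mul_sum]; exact Finset.sum_congr rfl fun i _ => by ring
          _ = 0 := by rw [this, mul_zero]
  refine ⟨hs, fun j hj => ?_⟩
  have hsub := congrArg₂ (· - ·) (h j) (h l)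
  simp only [add_sub_add_right_eq_sub, ← Finset.sum_sub_distrib, sub_zero] at hsub
  rw [Finset.sum_eq_single j] at hsub
  · simpa [hj, centeredBasis, hj.symm, mul_sub] using hsub
  · intro k _ hk
    by_cases hkl : k = l
    · simp [hkl]
    · simp [hkl, centeredBasis, Ne.symm hk, Ne.symm hkl]
  · simp

theorem discrim_pos_of_lt_min_or_gt_max {α β : ℝ}
    (h : α < min ((3 - 2 * Real.sqrt 2) * β) ((3 + 2 * Real.sqrt 2) * β) ∨
         α > max ((3 - 2 * Real.sqrt 2) * β) ((3 + 2 * Real.sqrt 2) * β)) :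
    0 < α ^ 2 + β ^ 2 - 6 * α * β := by
  have h2 : Real.sqrt 2 ^ 2 = 2 := Real.sq_sqrt (by norm_num)
  have hfac : α ^ 2 + β ^ 2 - 6 * α * β =
      (α - (3 - 2 * Real.sqrt 2) * β) * (α - (3 + 2 * Real.sqrt 2) * β) := by
    linear_combination (4 * β ^ 2) * h2
  rw [hfac]
  rcases h with h | h
  · obtain ⟨h₁, h₂⟩ := lt_min_iff.1 h
    exact mul_pos_of_neg_of_neg (sub_neg.2 h₁) (sub_neg.2 h₂)
  · obtain ⟨h₁, h₂⟩ := max_lt_iff.1 h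
    exact mul_pos (sub_pos.2 h₁) (sub_pos.2 h₂)

/-- The eigenvector matrix of `transM n α β a b`, with the two eigenvectors that are constant on
each block placed at the index `l` of the two blocks. -/
def eigenvectorMatrix {n : ℕ} (α t₃ t₄ : ℝ) (a b : Fin n → ℝ) (l : Fin n) :
    Matrix (Fin n ⊕ Fin n) (Fin n ⊕ Fin n) ℝ :=
  Matrix.of fun i j => Sum.elim
    (fun j => if j = l then Sum.elim (fun _ => α) (fun _ => t₃) i
      else Sum.elim (centeredBasis b j) 0 i)
    (fun j => if j = l then Sum.elim (fun _ => α) (fun _ => t₄) i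
      else Sum.elim 0 (centeredBasis a j) i) j

theorem isUnit_eigenvectorMatrix {n : ℕ} {α t₃ t₄ : ℝ} {a b : Fin n → ℝ}
    (ha : ∑ i, a i = 1) (hb : ∑ i, b i = 1) (hα : α ≠ 0) (ht : t₃ ≠ t₄) (l : Fin n) :
    IsUnit (eigenvectorMatrix α t₃ t₄ a b l) := by
  rw [← Matrix.mulVec_injective_iff_isUnit, ← Matrix.coe_mulVecLin, injective_iff_map_eq_zero]
  intro v hv
  rw [Matrix.mulVecLin_apply] at hv
  have split (f g : Fin n → ℝ) : ∑ j, (if j = l then f j else g j) =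
      ∑ j, (if j = l then 0 else g j) + f l := by
    rw [← Finset.sum_ite_eq_of_mem' Finset.univ l f (Finset.mem_univ l), ← Finset.sum_add_distrib]
    refine Finset.sum_congr rfl fun j _ => ?_
    split_ifs <;> simp
  obtain ⟨h₁, hv₁⟩ := eq_zero_of_centeredBasis_combination hb l (fun j => v (.inl j))
    (α * v (.inl l) + α * v (.inr l)) fun i => by
      have := congrFun hv (.inl i)
      simp only [Matrix.mulVec, dotProduct, eigenvectorMatrix, Matrix.of_apply, Fintype.sum_sum_type,
        Sum.elim_inl, Sum.elim_inr, ite_mul, Pi.zero_apply, zero_mul] at this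
      rw [split (fun j => α * v (.inl j)), split (fun j => α * v (.inr j))] at this
      simp only [ite_self, Finset.sum_const_zero] at this
      simp only [mul_comm (v _)]
      linarith
  obtain ⟨h₂, hv₂⟩ := eq_zero_of_centeredBasis_combination ha l (fun j => v (.inr j))
    (t₃ * v (.inl l) + t₄ * v (.inr l)) fun i => by
      have := congrFun hv (.inr i)
      simp only [Matrix.mulVec, dotProduct, eigenvectorMatrix, Matrix.of_apply, Fintype.sum_sum_type,
        Sum.elim_inl, Sum.elim_inr, ite_mul, Pi.zero_apply, zero_mul] at this
      rw [split (fun j => t₃ * v (.inl j)), split (fun j => t₄ * v (.inr j))] at this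
      simp only [ite_self, Finset.sum_const_zero] at this
      simp only [mul_comm (v _)]
      linarith
  have hsum : v (.inl l) + v (.inr l) = 0 :=
    (mul_eq_zero.1 ((mul_add _ _ _).trans h₁)).resolve_left hα
  have hl : v (.inl l) = 0 := by
    refine (mul_eq_zero.1 (?_ : (t₃ - t₄) * v (.inl l) = 0)).resolve_left (sub_ne_zero.2 ht)
    linear_combination h₂ - t₄ * hsum
  have hr : v (.inr l) = 0 := by linarith
  ext (j | j)
  · by_cases hj : j = l
    · rw [hj, hl, Pi.zero_apply]
    · exact hv₁ j hj
  · by_cases hj : j = l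
    · rw [hj, hr, Pi.zero_apply]
    · exact hv₂ j hj

/-- Block-constant eigenvectors of `transM` come from roots of
`(μ - 1 + α) * (μ - 1 + β) = -α * β`. -/
theorem transM_mulVec_const {n : ℕ} {α β μ : ℝ} {a b : Fin n → ℝ}
    (ha : ∑ i, a i = 1) (hb : ∑ i, b i = 1) (hμ : (μ - 1 + α) * (μ - 1 + β) = -α * β) :
    transM n α β a b *ᵥ Sum.elim (fun _ => α) (fun _ => μ - 1 + α) =
      μ • Sum.elim (fun _ => α) (fun _ => μ - 1 + α) := by
  rw [transM_mulVec]
  ext (i | i)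
  · simp only [dotProduct, ← Finset.sum_mul, ha, Sum.elim_inl, Pi.smul_apply, smul_eq_mul]
    ring
  · simp only [dotProduct, ← Finset.sum_mul, hb, Sum.elim_inr, Pi.smul_apply, smul_eq_mul]
    linear_combination -hμ

theorem transM_mulVec_inl {n : ℕ} {α β : ℝ} {a b : Fin n → ℝ} (hb : ∑ i, b i = 1) (j : Fin n) :
    transM n α β a b *ᵥ Sum.elim (centeredBasis b j) 0 =
      (1 - α) • Sum.elim (centeredBasis b j) 0 := by
  rw [transM_mulVec, dotProduct_centeredBasis hb]
  ext (i | i) <;> simp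

theorem transM_mulVec_inr {n : ℕ} {α β : ℝ} {a b : Fin n → ℝ} (ha : ∑ i, a i = 1) (j : Fin n) :
    transM n α β a b *ᵥ Sum.elim (0 : Fin n → ℝ) (centeredBasis a j) =
      (1 - β) • Sum.elim (0 : Fin n → ℝ) (centeredBasis a j) := by
  rw [transM_mulVec, dotProduct_centeredBasis ha]
  ext (i | i) <;> simp

/-- if α ≠ 0, β ≠ 0 and α < min(d₁,d₂) or α > max(d₁,d₂) (equivalently
Δ > 0), then M is diagonalizable over ℝ: there is an invertible Q with
Q⁻¹MQ = diag(λ₁ I_{n−1}, λ₃, λ₂ I_{n−1}, λ₄), where λ₁ = 1−α, λ₂ = 1−β,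
λ₃ = (2 − α − β + √Δ)/2, λ₄ = (2 − α − β − √Δ)/2. -/
theorem M_diagonalizable (n : ℕ) (hn : 2 ≤ n) (α β : ℝ) (a b : Fin n → ℝ)
    (ha : (∀ i, 0 < a i) ∧ ∑ i, a i = 1)
    (hb : (∀ i, 0 < b i) ∧ ∑ i, b i = 1)
    (hα : α ≠ 0) (hβ : β ≠ 0)
    (h : α < min ((3 - 2 * Real.sqrt 2) * β) ((3 + 2 * Real.sqrt 2) * β) ∨
         α > max ((3 - 2 * Real.sqrt 2) * β) ((3 + 2 * Real.sqrt 2) * β)) :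
    ∃ Q : Matrix (Fin n ⊕ Fin n) (Fin n ⊕ Fin n) ℝ,
      IsUnit Q ∧
      Q⁻¹ * transM n α β a b * Q =
        diagJ n (1 - α) ((2 - α - β + Real.sqrt (α ^ 2 + β ^ 2 - 6 * α * β)) / 2)
          (1 - β) ((2 - α - β - Real.sqrt (α ^ 2 + β ^ 2 - 6 * α * β)) / 2) := by
  set Δ := α ^ 2 + β ^ 2 - 6 * α * β with hΔ
  have hpos : 0 < Δ := discrim_pos_of_lt_min_or_gt_max h
  have hsq : Real.sqrt Δ ^ 2 = Δ := Real.sq_sqrt hpos.le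
  have hsqrt : 0 < Real.sqrt Δ := Real.sqrt_pos.2 hpos
  set μ₃ := (2 - α - β + Real.sqrt Δ) / 2 with hμ₃
  set μ₄ := (2 - α - β - Real.sqrt Δ) / 2 with hμ₄
  have hroot₃ : (μ₃ - 1 + α) * (μ₃ - 1 + β) = -α * β := by
    rw [hμ₃]
    linear_combination (hsq + hΔ) / 4
  have hroot₄ : (μ₄ - 1 + α) * (μ₄ - 1 + β) = -α * β := by
    rw [hμ₄]
    linear_combination (hsq + hΔ) / 4
  let l : Fin n := ⟨n - 1, by omega⟩
  have hlt (j : Fin n) : (j : ℕ) < n - 1 ↔ j ≠ l := by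
    rw [Ne, Fin.ext_iff]
    change _ ↔ ¬(j : ℕ) = n - 1
    omega
  have hQ : IsUnit (eigenvectorMatrix α (μ₃ - 1 + α) (μ₄ - 1 + α) a b l) :=
    isUnit_eigenvectorMatrix ha.2 hb.2 hα (by intro; linarith) l
  refine ⟨_, hQ, ?_⟩
  rw [Matrix.isUnit_iff_isUnit_det] at hQ
  have hcol : transM n α β a b * eigenvectorMatrix α (μ₃ - 1 + α) (μ₄ - 1 + α) a b l =
      eigenvectorMatrix α (μ₃ - 1 + α) (μ₄ - 1 + α) a b l * diagJ n (1 - α) μ₃ (1 - β) μ₄ := by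
    ext i (j | j)
    all_goals
      rw [diagJ, Matrix.mul_diagonal, mul_comm (eigenvectorMatrix _ _ _ _ _ _ _ _)]
      by_cases hj : j = l
    · simpa [Matrix.mul_apply, eigenvectorMatrix, hlt, hj, Matrix.mulVec, dotProduct] using
        congrFun (transM_mulVec_const ha.2 hb.2 hroot₃) i
    · simpa [Matrix.mul_apply, eigenvectorMatrix, hlt, hj, Matrix.mulVec, dotProduct] using
        congrFun (transM_mulVec_inl (α := α) (β := β) (a := a) hb.2 j) i
    · simpa [Matrix.mul_apply, eigenvectorMatrix, hlt, hj, Matrix.mulVec, dotProduct] using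
        congrFun (transM_mulVec_const ha.2 hb.2 hroot₄) i
    · simpa [Matrix.mul_apply, eigenvectorMatrix, hlt, hj, Matrix.mulVec, dotProduct] using
        congrFun (transM_mulVec_inr (α := α) (β := β) (b := b) ha.2 j) i
  rw [Matrix.mul_assoc, hcol, Matrix.nonsing_inv_mul_cancel_left _ _ hQ]
end

section
/- If β ≠ 0 and α = d₁ or α = d₂ (equivalently Δ = 0), then M cannot be diagonalized over ℝ, but there exists an invertible matrix Q ∈ M_{2n}(ℝ) such that Q⁻¹ M Q = diag(λ₁ I_{n−1}, λ₂ I_{n−1}, J₂(λ₃)), the block-diagonal matrix with first n−1 diagonal entries λ₁ = 1−α, next n−1 diagonal entries λ₂ = 1−β, and final 2×2 block the Jordan block J₂(λ₃) = [[λ₃, 1],[0, λ₃]] with λ₃ = 1 − (α+β)/2. -/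
open Matrix

/-- The position (0-based) of an index of `Fin n ⊕ Fin n` in the usual ordering 1,…,2n. -/
def pos (n : ℕ) : Fin n ⊕ Fin n → ℕ := Sum.elim (fun i => (i : ℕ)) (fun i => n + (i : ℕ))

/-- The block-diagonal matrix diag(λ₁ I_{n−1}, λ₂ I_{n−1}, J₂(λ₃)): its first n−1
diagonal entries are λ₁, the next n−1 diagonal entries are λ₂, and its final 2×2
diagonal block is the Jordan block [[λ₃, 1],[0, λ₃]]. -/
noncomputable def jordanJ (n : ℕ) (l1 l2 l3 : ℝ) :
    Matrix (Fin n ⊕ Fin n) (Fin n ⊕ Fin n) ℝ :=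
  Matrix.of fun r c =>
    if pos n r = pos n c then
      (if pos n r < n - 1 then l1 else if pos n r < 2 * n - 2 then l2 else l3)
    else if pos n r = 2 * n - 2 ∧ pos n c = 2 * n - 1 then 1 else 0

/-- The eigenvectors and generalized eigenvectors of `transM`, as columns. -/
noncomputable def jordanCols (m : ℕ) (α β : ℝ) (a b : Fin (m + 1) → ℝ) :
    Matrix (Fin (m + 1) ⊕ Fin (m + 1)) ((Fin m ⊕ Fin m) ⊕ Fin 2) ℝ :=
  Matrix.of <| Sum.elim
    (fun i => Sum.elim
      (Sum.elim (fun j => (if i = j.castSucc then 1 else 0) - b j.castSucc) fun _ => 0)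
      ![(β - α) / 2, 1])
    (fun i => Sum.elim
      (Sum.elim (fun _ => 0) fun j => (if i = j.castSucc then 1 else 0) - a j.castSucc)
      ![-β, 0])

/-- The Jordan form of `transM`, with rows and columns indexed by blocks. -/
noncomputable def jordanBlocks (m : ℕ) (l1 l2 l3 : ℝ) :
    Matrix ((Fin m ⊕ Fin m) ⊕ Fin 2) ((Fin m ⊕ Fin m) ⊕ Fin 2) ℝ :=
  Matrix.fromBlocks (Matrix.fromBlocks (l1 • 1) 0 0 (l2 • 1)) 0 0 !![l3, 1; 0, l3]

theorem transM_mul_jordanCols {m : ℕ} {α β : ℝ} {a b : Fin (m + 1) → ℝ}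
    (ha : ∑ i, a i = 1) (hb : ∑ i, b i = 1) (hΔ : α ^ 2 + β ^ 2 - 6 * α * β = 0) :
    transM (m + 1) α β a b * jordanCols m α β a b =
      jordanCols m α β a b * jordanBlocks m (1 - α) (1 - β) (1 - (α + β) / 2) := by
  ext (i | i) ((j | j) | j)
  · simp [transM, jordanCols, jordanBlocks, Matrix.mul_apply, Matrix.one_apply, mul_sub]
    split_ifs <;> ring
  · simp [transM, jordanCols, jordanBlocks, Matrix.mul_apply, Matrix.one_apply, mul_sub,
      Finset.sum_sub_distrib, ← Finset.mul_sum, ← Finset.sum_mul, ha]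
  · fin_cases j <;>
    simp [transM, jordanCols, jordanBlocks, Matrix.mul_apply, Matrix.one_apply,
      ← Finset.mul_sum, ← Finset.sum_mul, ha]
    · linear_combination (1 / 4 : ℝ) * hΔ
    · ring
  · simp [transM, jordanCols, jordanBlocks, Matrix.mul_apply, Matrix.one_apply, mul_sub,
      Finset.sum_add_distrib, ← Finset.mul_sum, ← Finset.sum_mul, hb]
  · simp [transM, jordanCols, jordanBlocks, Matrix.mul_apply, Matrix.one_apply, mul_sub]
    split_ifs <;> ring
  · fin_cases j <;>
    simp [transM, jordanCols, jordanBlocks, Matrix.mul_apply, Matrix.one_apply,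
      ← Finset.mul_sum, ← Finset.sum_mul, hb]
    ring

theorem jordanCols_mulVec_injective {m : ℕ} {α β : ℝ} (hβ : β ≠ 0) (a b : Fin (m + 1) → ℝ) :
    Function.Injective (jordanCols m α β a b).mulVec := by
  refine (injective_iff_map_eq_zero (jordanCols m α β a b).mulVecLin).2 fun v hv => ?_
  have hl (i : Fin (m + 1)) := congrFun hv (Sum.inl i)
  have hr (i : Fin (m + 1)) := congrFun hv (Sum.inr i)
  simp only [mulVecLin_apply, mulVec, dotProduct, jordanCols, of_apply, Sum.elim_inl, Sum.elim_inr,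
    Fintype.sum_sum_type, Fin.sum_univ_two, sub_mul, Finset.sum_sub_distrib, ite_mul, one_mul,
    zero_mul, Finset.sum_const_zero, Pi.zero_apply, cons_val_zero, cons_val_one] at hl hr
  have hl' := hl (Fin.last m)
  have hr' := hr (Fin.last m)
  simp [(Fin.castSucc_ne_last _).symm] at hl' hr'
  have hp (j : Fin m) : v (.inl (.inl j)) = 0 := by
    have := hl j.castSucc
    simp at this
    linarith
  have hq (j : Fin m) : v (.inl (.inr j)) = 0 := by
    have := hr j.castSucc
    simp at this
    linarith
  simp [hp, hq, hβ] at hl' hr'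
  simp [hr'] at hl'
  ext ((j | j) | j)
  · exact hp j
  · exact hq j
  · fin_cases j
    · exact hr'
    · exact hl'

/-- The equivalence placing the Jordan blocks in the usual ordering of `Fin n ⊕ Fin n`. -/
def blockEquiv (m : ℕ) : (Fin m ⊕ Fin m) ⊕ Fin 2 ≃ Fin (m + 1) ⊕ Fin (m + 1) :=
  (finSumFinEquiv.sumCongr (Equiv.refl _)).trans <| finSumFinEquiv.trans <|
    (finCongr (by omega : m + m + 2 = m + 1 + (m + 1))).trans finSumFinEquiv.symm

theorem pos_eq_finSumFinEquiv {n : ℕ} (s : Fin n ⊕ Fin n) : pos n s = finSumFinEquiv s := by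
  cases s <;> simp [pos, add_comm]

theorem pos_blockEquiv (m : ℕ) (s : (Fin m ⊕ Fin m) ⊕ Fin 2) :
    pos (m + 1) (blockEquiv m s) =
      Sum.elim (Sum.elim (fun j : Fin m => (j : ℕ)) fun j : Fin m => m + j)
        (fun j : Fin 2 => m + m + j) s := by
  rw [pos_eq_finSumFinEquiv]
  rcases s with (j | j) | j <;> simp [blockEquiv, add_comm]

theorem jordanJ_submatrix_blockEquiv (m : ℕ) (l1 l2 l3 : ℝ) :
    (jordanJ (m + 1) l1 l2 l3).submatrix (blockEquiv m) (blockEquiv m) =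
      jordanBlocks m l1 l2 l3 := by
  ext r c
  simp only [submatrix_apply, jordanJ, of_apply, pos_blockEquiv]
  rcases r with (i | i) | i <;> rcases c with (j | j) | j
  all_goals
    (try fin_cases i) <;> (try fin_cases j) <;>
      simp [jordanBlocks, Matrix.one_apply, Fin.ext_iff] <;> grind

/-- A diagonalizable matrix has no Jordan chain of length two. -/
theorem eq_zero_of_isDiag_conj {ι K : Type*} [Fintype ι] [DecidableEq ι] [Field K]
    {A Q : Matrix ι ι K} (hQ : IsUnit Q) (hD : (Q⁻¹ * A * Q).IsDiag) {c : K} {u v : ι → K}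
    (hv : A *ᵥ v = c • v + u) (hu : A *ᵥ u = c • u) : u = 0 := by
  have hdet := (isUnit_iff_isUnit_det Q).1 hQ
  obtain ⟨d, hd⟩ : ∃ d, Q⁻¹ * A * Q = diagonal d := ⟨_, hD.diagonal_diag.symm⟩
  have key (w : ι → K) : Q⁻¹ *ᵥ (A *ᵥ w) = diagonal d *ᵥ (Q⁻¹ *ᵥ w) := by
    rw [← hd, mulVec_mulVec, mulVec_mulVec, mul_assoc, mul_nonsing_inv _ hdet, mul_one]
  have hz : Q⁻¹ *ᵥ u = 0 := by
    ext i
    have h1 := congrFun (key v) i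
    have h2 := congrFun (key u) i
    rw [hv, mulVec_add, mulVec_smul] at h1
    rw [hu, mulVec_smul] at h2
    simp only [Pi.add_apply, Pi.smul_apply, smul_eq_mul, mulVec_diagonal, Pi.zero_apply] at h1 h2 ⊢
    refine pow_eq_zero_iff two_ne_zero |>.1 ?_
    linear_combination (Q⁻¹ *ᵥ u) i * h1 - (Q⁻¹ *ᵥ v) i * h2
  simpa [mulVec_mulVec, mul_nonsing_inv _ hdet] using congrArg (Q *ᵥ ·) hz

/-- if β ≠ 0 and α = d₁ or α = d₂ (equivalently Δ = 0), then M cannot be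
diagonalized over ℝ, but there is an invertible Q with
Q⁻¹MQ = diag(λ₁ I_{n−1}, λ₂ I_{n−1}, J₂(λ₃)), where λ₁ = 1−α, λ₂ = 1−β and
λ₃ = 1 − (α+β)/2. -/
theorem M_jordan_form_degenerate (n : ℕ) (hn : 2 ≤ n) (α β : ℝ) (a b : Fin n → ℝ)
    (ha : (∀ i, 0 < a i) ∧ ∑ i, a i = 1)
    (hb : (∀ i, 0 < b i) ∧ ∑ i, b i = 1)
    (hβ : β ≠ 0)
    (h : α = (3 - 2 * Real.sqrt 2) * β ∨ α = (3 + 2 * Real.sqrt 2) * β) :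
    (¬ ∃ Q : Matrix (Fin n ⊕ Fin n) (Fin n ⊕ Fin n) ℝ,
        IsUnit Q ∧ (Q⁻¹ * transM n α β a b * Q).IsDiag) ∧
    ∃ Q : Matrix (Fin n ⊕ Fin n) (Fin n ⊕ Fin n) ℝ,
      IsUnit Q ∧
      Q⁻¹ * transM n α β a b * Q = jordanJ n (1 - α) (1 - β) (1 - (α + β) / 2) := by
  have hΔ : α ^ 2 + β ^ 2 - 6 * α * β = 0 := by
    have h2 : Real.sqrt 2 ^ 2 = 2 := Real.sq_sqrt (by norm_num)
    rcases h with rfl | rfl <;> linear_combination 4 * β ^ 2 * h2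
  obtain ⟨m, rfl⟩ : ∃ m, n = m + 1 := ⟨n - 1, by omega⟩
  have hMQ := transM_mul_jordanCols ha.2 hb.2 hΔ
  refine ⟨fun ⟨Q, hQ, hD⟩ => ?_, ?_⟩
  · have hchain (j) := congrArg (fun B => B.col j) hMQ
    have hu : (jordanCols m α β a b).col (.inr 0) = 0 := by
      refine eq_zero_of_isDiag_conj (c := 1 - (α + β) / 2)
        (v := (jordanCols m α β a b).col (.inr 1)) hQ hD ?_ ?_
      · refine (hchain (.inr 1)).trans ?_
        ext i
        simp [Matrix.mul_apply, jordanBlocks]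
        ring
      · refine (hchain (.inr 0)).trans ?_
        ext i
        simp [Matrix.mul_apply, jordanBlocks]
        ring
    have := congrFun hu (.inr 0)
    simp [jordanCols, hβ] at this
  · have hQ : IsUnit ((jordanCols m α β a b).submatrix id (blockEquiv m).symm) := by
      rw [← mulVec_injective_iff_isUnit]
      intro v w hvw
      simp only [submatrix_mulVec_equiv, Function.comp_id, Equiv.symm_symm] at hvw
      exact (blockEquiv m).surjective.injective_comp_right
        (jordanCols_mulVec_injective hβ a b hvw)
    refine ⟨_, hQ, ?_⟩
    have hJ : jordanJ (m + 1) (1 - α) (1 - β) (1 - (α + β) / 2) =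
        (jordanBlocks m (1 - α) (1 - β) (1 - (α + β) / 2)).submatrix
          (blockEquiv m).symm (blockEquiv m).symm := by
      rw [← jordanJ_submatrix_blockEquiv]
      simp
    rw [mul_assoc, hJ]
    have : transM (m + 1) α β a b * (jordanCols m α β a b).submatrix id (blockEquiv m).symm =
        (jordanCols m α β a b).submatrix id (blockEquiv m).symm *
          (jordanBlocks m (1 - α) (1 - β) (1 - (α + β) / 2)).submatrix
            (blockEquiv m).symm (blockEquiv m).symm := by
      rw [submatrix_mul_equiv, ← hMQ]
      rfl
    rw [this, ← mul_assoc, nonsing_inv_mul _ ((isUnit_iff_isUnit_det _).1 hQ), one_mul]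
end

section
/- If β ≠ 0 and α = d₁ or α = d₂ (equivalently Δ = 0), then rank(M − λ₃ I_{2n}) = 2n − 1, where λ₃ = 1 − (α+β)/2; equivalently, the eigenvalue λ₃ of M has geometric multiplicity 1. -/
open Matrix

/-- The kernel of `!![c 1, α 1ᵀa; -β 1ᵀb, -c 1]` is spanned by a blockwise constant vector as soon
as `c ^ 2 = α * β` with `c ≠ 0`. -/
theorem ker_transM_sub_smul_one_eq_span {n : ℕ} {α β c l : ℝ} {a b : Fin n → ℝ}
    (ha : ∑ i, a i = 1) (hb : ∑ i, b i = 1) (hc : c ≠ 0) (hcc : c * c = α * β)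
    (hα : 1 - α - l = c) (hβ : 1 - β - l = -c) :
    LinearMap.ker (transM n α β a b - l • 1).mulVecLin =
      Submodule.span ℝ {Sum.elim (fun _ => c) (fun _ => -β)} := by
  have hM : transM n α β a b - l • 1 =
      Matrix.fromBlocks (c • 1) (Matrix.of fun _ j => α * a j)
        (Matrix.of fun _ j => -β * b j) ((-c) • 1) := by
    rw [transM, ← Matrix.fromBlocks_one, Matrix.fromBlocks_smul, sub_eq_add_neg,
      Matrix.fromBlocks_neg, Matrix.fromBlocks_add, ← hβ, ← hα, sub_smul _ l, sub_smul _ l]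
    simp [sub_eq_add_neg]
  have key (w : Fin n ⊕ Fin n → ℝ) :
      w ∈ LinearMap.ker (transM n α β a b - l • 1).mulVecLin ↔
        (∀ i, c * w (.inl i) + α * ∑ j, a j * w (.inr j) = 0) ∧
        ∀ i, -β * ∑ j, b j * w (.inl j) - c * w (.inr i) = 0 := by
    rw [LinearMap.mem_ker, hM, Matrix.mulVecLin_apply, Matrix.fromBlocks_mulVec, funext_iff,
      Sum.forall]
    simp only [Sum.elim_inl, Sum.elim_inr, Pi.add_apply, Matrix.smul_mulVec,
      Matrix.one_mulVec, Pi.smul_apply, Function.comp_apply, smul_eq_mul, Pi.zero_apply,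
      Matrix.mulVec, dotProduct, Matrix.of_apply, mul_assoc, ← Finset.mul_sum,
      neg_mul, Finset.sum_neg_distrib, sub_eq_add_neg]
  ext w
  rw [key, Submodule.mem_span_singleton]
  constructor
  · rintro ⟨h₁, h₂⟩
    set t := ∑ j, a j * w (.inr j)
    set s := ∑ j, b j * w (.inl j) with hs
    have hx (i : Fin n) : w (.inl i) = -(α * t) / c := by
      rw [eq_div_iff hc]
      linarith [h₁ i]
    have hst : s = -(α * t) / c := by
      simp only [hs, hx, ← Finset.sum_mul, hb, one_mul]
    refine ⟨s / c, ?_⟩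
    ext (i | i)
    · simp [hx, hst, hc]
    · simp only [Pi.smul_apply, Sum.elim_inr, smul_eq_mul]
      rw [div_mul_eq_mul_div, div_eq_iff hc]
      linarith [h₂ i]
  · rintro ⟨r, rfl⟩
    simp only [Pi.smul_apply, Sum.elim_inl, Sum.elim_inr, smul_eq_mul, ← Finset.sum_mul, ha, hb]
    refine ⟨fun _ => ?_, fun _ => ?_⟩
    · linear_combination r * hcc
    · ring

/-- if β ≠ 0 and α = d₁ or α = d₂ (equivalently Δ = 0), then
rank(M − λ₃ I₂ₙ) = 2n − 1 where λ₃ = 1 − (α+β)/2; equivalently, the eigenvalue λ₃ has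
geometric multiplicity 1. -/
theorem rank_of_M_sub_lambda3_degenerate (n : ℕ) (hn : 2 ≤ n) (α β : ℝ)
    (a b : Fin n → ℝ)
    (ha : (∀ i, 0 < a i) ∧ ∑ i, a i = 1)
    (hb : (∀ i, 0 < b i) ∧ ∑ i, b i = 1)
    (hβ : β ≠ 0)
    (h : α = (3 - 2 * Real.sqrt 2) * β ∨ α = (3 + 2 * Real.sqrt 2) * β) :
    (transM n α β a b - (1 - (α + β) / 2) • 1).rank = 2 * n - 1 ∧
    Module.finrank ℝ
      (LinearMap.ker (transM n α β a b - (1 - (α + β) / 2) • 1).mulVecLin) = 1 := by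
  have hΔ : α ^ 2 + β ^ 2 - 6 * α * β = 0 := by
    have h2 : Real.sqrt 2 ^ 2 = 2 := Real.sq_sqrt (by norm_num)
    rcases h with rfl | rfl <;> linear_combination 4 * β ^ 2 * h2
  have hc : (β - α) / 2 ≠ 0 := by
    intro h0
    obtain rfl : α = β := by linarith
    have : α ^ 2 = 0 := by linarith
    exact hβ (pow_eq_zero_iff two_ne_zero |>.mp this)
  have hker : Module.finrank ℝ
      (LinearMap.ker (transM n α β a b - (1 - (α + β) / 2) • 1).mulVecLin) = 1 := by
    rw [ker_transM_sub_smul_one_eq_span ha.2 hb.2 hc (by linear_combination hΔ / 4) (by ring)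
      (by ring)]
    refine finrank_span_singleton fun h0 => hc ?_
    simpa using congrFun h0 (.inl ⟨0, by omega⟩)
  refine ⟨?_, hker⟩
  have hrank := LinearMap.finrank_range_add_finrank_ker
    (transM n α β a b - (1 - (α + β) / 2) • 1).mulVecLin
  rw [hker, Module.finrank_fintype_fun_eq_card, Fintype.card_sum, Fintype.card_fin] at hrank
  rw [Matrix.rank]
  omega
end
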